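/- arXiv:2406.16971 — 2 statements merged into one kernel-verified Lean document; each statement's English description precedes it below -/
import Mathlib

section
/- Fix λ > 0. Then z² − [(2/λ)·log(λ·S(z; λ) + 1) − log log(λ·S(z; λ) + 1) + log(λ/π)] → 0 as z → +∞; that is, if x = S(z; λ) then z² = (2/λ)·log(λx + 1) − log log(λx + 1) + log(λ/π) + o(1) as x → ∞. -/
open MeasureTheory Real Filter

/-- The complementary error function `erfc(z) = (2/√π) ∫_z^∞ exp(-t²) dt`. -/
noncomputable def erfc (z : ℝ) : ℝ :=
  (2 / Real.sqrt Real.pi) * ∫ t in Set.Ioi z, Real.exp (-t ^ 2)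

/-- The simplified TTF transformation `S(z; λ) = (1/λ)(erfc(z/√2)^(-λ) - 1)`. -/
noncomputable def ttf (lam z : ℝ) : ℝ :=
  (1 / lam) * ((erfc (z / Real.sqrt 2)) ^ (-lam) - 1)


lemma aux_int (w : ℝ) : IntegrableOn (fun t : ℝ => Real.exp (-t ^ 2)) (Set.Ioi w) := by
  have h := integrable_exp_neg_mul_sq (b := 1) one_pos
  simp only [neg_mul, one_mul] at h
  exact h.integrableOn

lemma aux_tend : Tendsto (fun t : ℝ => Real.exp (-t ^ 2)) atTop (nhds 0) :=
  Real.tendsto_exp_atBot.comp (tendsto_neg_atTop_atBot.comp (tendsto_pow_atTop two_ne_zero))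

lemma aux_der (t : ℝ) :
    HasDerivAt (fun t : ℝ => Real.exp (-t ^ 2)) (Real.exp (-t ^ 2) * (-(2 * t))) t := by
  have h := ((hasDerivAt_pow 2 t).fun_neg).exp
  simpa using h

lemma aux_upper (w : ℝ) (hw : 0 < w) :
    2 * w * Real.exp (w ^ 2) * ∫ t in Set.Ioi w, Real.exp (-t ^ 2) ≤ 1 := by
  have hd : ∀ t ∈ Set.Ici w, HasDerivAt (fun t : ℝ => - Real.exp (-t ^ 2))
      (2 * t * Real.exp (-t ^ 2)) t := by
    intro t _
    have h := (aux_der t).fun_neg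
    refine h.congr_deriv ?_
    ring
  have hpos : ∀ t ∈ Set.Ioi w, 0 ≤ 2 * t * Real.exp (-t ^ 2) := by
    intro t ht
    have : 0 < t := lt_trans hw ht
    positivity
  have ht : Tendsto (fun t : ℝ => - Real.exp (-t ^ 2)) atTop (nhds 0) := by
    simpa using aux_tend.neg
  have hi := integrableOn_Ioi_deriv_of_nonneg' hd hpos ht
  have he := integral_Ioi_of_hasDerivAt_of_tendsto' hd hi ht
  have hle : ∫ t in Set.Ioi w, 2 * w * Real.exp (-t ^ 2) ≤
      ∫ t in Set.Ioi w, 2 * t * Real.exp (-t ^ 2) := by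
    apply setIntegral_mono_on ((aux_int w).const_mul _) hi measurableSet_Ioi
    intro t ht
    have : w < t := ht
    gcongr
  rw [he, integral_const_mul] at hle
  have h2 : Real.exp (w ^ 2) * Real.exp (-w ^ 2) = 1 := by
    rw [← Real.exp_add]; simp
  have := mul_le_mul_of_nonneg_left hle (Real.exp_pos (w ^ 2)).le
  nlinarith

lemma aux_lower (w : ℝ) (hw : 0 < w) :
    (1 + 1 / (2 * w ^ 2))⁻¹ ≤
    2 * w * Real.exp (w ^ 2) * ∫ t in Set.Ioi w, Real.exp (-t ^ 2) := by
  have hd : ∀ t ∈ Set.Ici w, HasDerivAt (fun t : ℝ => - (Real.exp (-t ^ 2) * (2 * t)⁻¹))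
      ((1 + 1 / (2 * t ^ 2)) * Real.exp (-t ^ 2)) t := by
    intro t ht
    have ht0 : t ≠ 0 := (lt_of_lt_of_le hw ht).ne'
    have h1 : HasDerivAt (fun t : ℝ => Real.exp (-t ^ 2)) (Real.exp (-t ^ 2) * (-(2 * t))) t := aux_der t
    have h2 : HasDerivAt (fun t : ℝ => 2 * t) 2 t := by
      simpa using (hasDerivAt_id t).const_mul 2
    refine ((h1.fun_mul (h2.fun_inv (by simpa using ht0))).fun_neg).congr_deriv ?_
    field_simp
    ring
  have hpos : ∀ t ∈ Set.Ioi w, 0 ≤ (1 + 1 / (2 * t ^ 2)) * Real.exp (-t ^ 2) := by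
    intro t ht
    positivity
  have ht : Tendsto (fun t : ℝ => - (Real.exp (-t ^ 2) * (2 * t)⁻¹)) atTop (nhds 0) := by
    have h3 : Tendsto (fun t : ℝ => (2 * t)⁻¹) atTop (nhds 0) :=
      tendsto_inv_atTop_zero.comp (tendsto_id.const_mul_atTop two_pos)
    simpa using (aux_tend.mul h3).neg
  have hi := integrableOn_Ioi_deriv_of_nonneg' hd hpos ht
  have he := integral_Ioi_of_hasDerivAt_of_tendsto' hd hi ht
  have hle : ∫ t in Set.Ioi w, (1 + 1 / (2 * t ^ 2)) * Real.exp (-t ^ 2) ≤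
      ∫ t in Set.Ioi w, (1 + 1 / (2 * w ^ 2)) * Real.exp (-t ^ 2) := by
    apply setIntegral_mono_on hi ((aux_int w).const_mul _) measurableSet_Ioi
    intro t ht
    have : w < t := ht
    gcongr
  rw [he, integral_const_mul] at hle
  have h2 : Real.exp (w ^ 2) * Real.exp (-w ^ 2) = 1 := by
    rw [← Real.exp_add]; simp
  have h3 := mul_le_mul_of_nonneg_left hle (by positivity : 0 ≤ 2 * w * Real.exp (w ^ 2))
  have h4 : 2 * w * Real.exp (w ^ 2) * (0 - -(Real.exp (-w ^ 2) * (2 * w)⁻¹)) = 1 := by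
    field_simp
    linarith
  rw [h4] at h3
  rw [inv_le_iff_one_le_mul₀ (by positivity)]
  linarith

/-- Mills-type ratio. -/
noncomputable def auxR (w : ℝ) : ℝ :=
  2 * w * Real.exp (w ^ 2) * ∫ t in Set.Ioi w, Real.exp (-t ^ 2)

lemma auxR_tendsto : Tendsto auxR atTop (nhds 1) := by
  have h : Tendsto (fun w : ℝ => (1 + 1 / (2 * w ^ 2))⁻¹) atTop (nhds 1) := by
    have h1 : Tendsto (fun w : ℝ => 2 * w ^ 2) atTop atTop :=
      (tendsto_pow_atTop two_ne_zero).const_mul_atTop two_pos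
    have h2 : Tendsto (fun w : ℝ => 1 + 1 / (2 * w ^ 2)) atTop (nhds (1 + 0)) := by
      simp only [one_div]
      exact (tendsto_inv_atTop_zero.comp h1).const_add 1
    simpa using h2.inv₀ (by norm_num)
  refine tendsto_of_tendsto_of_tendsto_of_le_of_le' h tendsto_const_nhds ?_ ?_
  · filter_upwards [eventually_gt_atTop 0] with w hw using aux_lower w hw
  · filter_upwards [eventually_gt_atTop 0] with w hw using aux_upper w hw

lemma auxR_pos (w : ℝ) (hw : 0 < w) : 0 < auxR w :=
  lt_of_lt_of_le (by positivity) (aux_lower w hw)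

lemma erfc_eq (w : ℝ) (hw : 0 < w) :
    erfc w = auxR w * Real.exp (-w ^ 2) / (w * Real.sqrt Real.pi) := by
  have h2 : Real.exp (w ^ 2) * Real.exp (-w ^ 2) = 1 := by
    rw [← Real.exp_add]; simp
  have h3 : auxR w * Real.exp (-w ^ 2) = 2 * w * ∫ t in Set.Ioi w, Real.exp (-t ^ 2) := by
    unfold auxR
    linear_combination (2 * w * ∫ t in Set.Ioi w, Real.exp (-t ^ 2)) * h2
  rw [h3]
  unfold erfc
  field_simp

lemma erfc_pos' (w : ℝ) (hw : 0 < w) : 0 < erfc w := by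
  rw [erfc_eq w hw]
  have := auxR_pos w hw
  positivity

lemma log_erfc (w : ℝ) (hw : 0 < w) :
    - Real.log (erfc w) = w ^ 2 + Real.log w + Real.log Real.pi / 2 - Real.log (auxR w) := by
  have := auxR_pos w hw
  rw [erfc_eq w hw, Real.log_div (by positivity) (by positivity),
    Real.log_mul (by positivity) (by positivity), Real.log_mul (by positivity) (by positivity),
    Real.log_exp, Real.log_sqrt Real.pi_pos.le]
  ring

lemma log_auxR : Tendsto (fun w => Real.log (auxR w)) atTop (nhds 0) := by
  simpa using auxR_tendsto.log one_ne_zero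

lemma ratio_tendsto :
    Tendsto (fun w => - Real.log (erfc w) / w ^ 2) atTop (nhds 1) := by
  have h1 : Tendsto (fun w : ℝ => (w ^ 2)⁻¹) atTop (nhds 0) :=
    tendsto_inv_atTop_zero.comp (tendsto_pow_atTop two_ne_zero)
  have h2 : Tendsto (fun w : ℝ => Real.log w / w ^ 2) atTop (nhds 0) := by
    have := (isLittleO_log_rpow_atTop (r := 2) two_pos).tendsto_div_nhds_zero
    simpa using this
  have h3 : Tendsto (fun w : ℝ => 1 + Real.log w / w ^ 2 +
      (Real.log Real.pi / 2 - Real.log (auxR w)) * (w ^ 2)⁻¹) atTop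
      (nhds (1 + 0 + (Real.log Real.pi / 2 - 0) * 0)) :=
    (h2.const_add 1).add ((log_auxR.const_sub _).mul h1)
  simp only [mul_zero, add_zero] at h3
  refine h3.congr' ?_
  filter_upwards [eventually_gt_atTop 0] with w hw
  rw [log_erfc w hw]
  field_simp
  ring

/-- for fixed `λ > 0`,
`z² - [(2/λ) log(λ S(z;λ) + 1) - log log(λ S(z;λ) + 1) + log(λ/π)] → 0` as `z → ∞`. -/
theorem ttf_expansion_second_order (lam : ℝ) (hlam : 0 < lam) :
    Tendsto
      (fun z => z ^ 2 -
        ((2 / lam) * Real.log (lam * ttf lam z + 1)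
          - Real.log (Real.log (lam * ttf lam z + 1)) + Real.log (lam / Real.pi)))
      atTop (nhds 0) := by
  have hs : (0 : ℝ) < Real.sqrt 2 := by positivity
  have hw : Tendsto (fun z : ℝ => z / Real.sqrt 2) atTop atTop :=
    tendsto_id.atTop_div_const hs
  have hmain : Tendsto (fun w => 2 * Real.log (auxR w) +
      Real.log (- Real.log (erfc w) / w ^ 2)) atTop (nhds 0) := by
    simpa using (log_auxR.const_mul 2).add (ratio_tendsto.log one_ne_zero)
  refine (hmain.comp hw).congr' ?_
  have hp := (ratio_tendsto.comp hw).eventually (lt_mem_nhds (zero_lt_one))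
  filter_upwards [eventually_gt_atTop 0, hp] with z hz hz2
  have hw0 : 0 < z / Real.sqrt 2 := by positivity
  have hzw : z ^ 2 = 2 * (z / Real.sqrt 2) ^ 2 := by
    rw [div_pow, Real.sq_sqrt two_pos.le]; ring
  have hS : lam * ttf lam z + 1 = erfc (z / Real.sqrt 2) ^ (-lam) := by
    unfold ttf
    field_simp
    ring
  rw [hS, hzw]
  simp only [Function.comp] at hz2 ⊢
  generalize z / Real.sqrt 2 = w at *
  have hL : 0 < - Real.log (erfc w) := by
    have := mul_pos hz2 (pow_pos hw0 2)
    rwa [div_mul_cancel₀ _ (by positivity)] at this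
  rw [Real.log_rpow (erfc_pos' w hw0), neg_mul_comm,
    Real.log_mul hlam.ne' hL.ne', Real.log_div hL.ne' (by positivity),
    Real.log_div hlam.ne' Real.pi_pos.ne', Real.log_pow]
  have h := log_erfc w hw0
  have h5 : 2 / lam * (lam * - Real.log (erfc w)) = 2 * (- Real.log (erfc w)) := by
    field_simp
  rw [h5]
  push_cast
  linear_combination 2 * h
end

section
/- The TTF transformation R is differentiable at z = 0 with derivative R'(0) = σ·√(2/π), independent of λ₊ and λ₋; moreover the derivative of R is continuous at 0, i.e. R'(z) → σ·√(2/π) as z → 0 from above and from below. -/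
open MeasureTheory Real Filter

/-- The TTF transformation `R(z) = μ + σ (s/λ_s)(erfc(|z|/√2)^(-λ_s) - 1)`, where
`s = sign(z)` (`s = 1` for `z ≥ 0`, `s = -1` for `z < 0`), `λ_s = λ₊` when `s = 1`
and `λ_s = λ₋` when `s = -1`. -/
noncomputable def ttfR (m σ lp lm z : ℝ) : ℝ :=
  if 0 ≤ z then
    m + σ * ((1 / lp) * ((erfc (|z| / Real.sqrt 2)) ^ (-lp) - 1))
  else
    m + σ * ((-1 / lm) * ((erfc (|z| / Real.sqrt 2)) ^ (-lm) - 1))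

theorem gauss_integrable : Integrable (fun t : ℝ => Real.exp (-t ^ 2)) := by
  simpa using integrable_exp_neg_mul_sq (b := 1) one_pos

theorem erfc_zero : erfc 0 = 1 := by
  have h := integral_gaussian_Ioi 1
  have hp : Real.sqrt Real.pi ≠ 0 := (Real.sqrt_pos.2 Real.pi_pos).ne'
  simp only [neg_mul, one_mul, div_one] at h
  rw [erfc, h]
  field_simp

theorem erfc_pos (z : ℝ) : 0 < erfc z := by
  have hp : 0 < Real.sqrt Real.pi := Real.sqrt_pos.2 Real.pi_pos
  refine mul_pos (by positivity) ?_
  rw [setIntegral_pos_iff_support_of_nonneg_ae]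
  · have : (Function.support fun t : ℝ => Real.exp (-t ^ 2)) = Set.univ := by
      ext x
      simp [(Real.exp_pos _).ne']
    rw [this, Set.univ_inter, Real.volume_Ioi]
    simp
  · exact Eventually.of_forall fun x => (Real.exp_pos _).le
  · exact gauss_integrable.integrableOn

theorem erfc_hasDerivAt (z : ℝ) :
    HasDerivAt erfc (-(2 / Real.sqrt Real.pi * Real.exp (-z ^ 2))) z := by
  have hc : Continuous (fun t : ℝ => Real.exp (-t ^ 2)) := by fun_prop
  have h1 : HasDerivAt (fun u => ∫ t in (0 : ℝ)..u, Real.exp (-t ^ 2)) (Real.exp (-z ^ 2)) z :=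
    intervalIntegral.integral_hasDerivAt_right (hc.intervalIntegrable _ _)
      (hc.stronglyMeasurableAtFilter _ _) hc.continuousAt
  have h2 : erfc = fun u => 2 / Real.sqrt Real.pi *
      ((∫ t in Set.Ioi (0 : ℝ), Real.exp (-t ^ 2)) - ∫ t in (0 : ℝ)..u, Real.exp (-t ^ 2)) := by
    funext u
    have := intervalIntegral.integral_interval_add_Ioi (a := 0) (b := u)
      gauss_integrable.integrableOn gauss_integrable.integrableOn
    rw [erfc, ← this]
    ring
  rw [h2]
  refine ((h1.const_sub _).const_mul (2 / Real.sqrt Real.pi)).congr_deriv ?_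
  ring

noncomputable def ttfG (l w : ℝ) : ℝ := (1 / l) * ((erfc (w / Real.sqrt 2)) ^ (-l) - 1)

noncomputable def ttfD (l w : ℝ) : ℝ :=
  2 / Real.sqrt Real.pi * Real.exp (-(w / Real.sqrt 2) ^ 2) * (1 / Real.sqrt 2) *
    (erfc (w / Real.sqrt 2)) ^ (-l - 1)

theorem ttfG_zero (l : ℝ) : ttfG l 0 = 0 := by simp [ttfG, erfc_zero]

theorem ttfD_zero (l : ℝ) : ttfD l 0 = Real.sqrt (2 / Real.pi) := by
  have h2 : Real.sqrt 2 ≠ 0 := by positivity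
  have hp : Real.sqrt Real.pi ≠ 0 := (Real.sqrt_pos.2 Real.pi_pos).ne'
  have h : Real.sqrt 2 ^ 2 = 2 := Real.sq_sqrt (by norm_num)
  rw [Real.sqrt_div (by norm_num)]
  simp only [ttfD, zero_div, erfc_zero, Real.one_rpow]
  norm_num
  field_simp
  linarith

theorem ttfG_hasDerivAt {l : ℝ} (hl : 0 < l) (w : ℝ) : HasDerivAt (ttfG l) (ttfD l w) w := by
  have h1 : HasDerivAt (fun w : ℝ => w / Real.sqrt 2) (1 / Real.sqrt 2) w :=
    (hasDerivAt_id w).div_const _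
  have h2 := (erfc_hasDerivAt (w / Real.sqrt 2)).comp w h1
  have h3 := ((h2.rpow_const (p := -l) (Or.inl (erfc_pos _).ne')).sub_const 1).const_mul (1 / l)
  refine h3.congr_deriv ?_
  simp only [ttfD, Function.comp]
  field_simp

theorem ttfD_continuous (l : ℝ) : Continuous (ttfD l) := by
  have he : Continuous erfc :=
    continuous_iff_continuousAt.2 fun z => (erfc_hasDerivAt z).continuousAt
  have h : Continuous fun w : ℝ => (erfc (w / Real.sqrt 2)) ^ (-l - 1) :=
    (he.comp (continuous_id.div_const _)).rpow_const fun w => Or.inl (erfc_pos _).ne'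
  unfold ttfD
  exact Continuous.mul (by fun_prop) h

theorem ttfR_nonneg (m σ lp lm : ℝ) {z : ℝ} (hz : 0 ≤ z) :
    ttfR m σ lp lm z = m + σ * ttfG lp z := by
  simp [ttfR, ttfG, hz, abs_of_nonneg hz]

theorem ttfR_nonpos (m σ lp lm : ℝ) {z : ℝ} (hz : z ≤ 0) :
    ttfR m σ lp lm z = m - σ * ttfG lm (-z) := by
  rcases hz.lt_or_eq with h | h
  · rw [ttfR, if_neg (not_le.2 h), abs_of_neg h, ttfG]
    ring
  · subst h
    rw [ttfR_nonneg m σ lp lm le_rfl]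
    simp [ttfG_zero]

/-- the TTF transformation is differentiable at `0` with derivative
`σ √(2/π)`, independent of `λ₊` and `λ₋`; moreover its derivative is continuous at `0`,
i.e. `R'(z) → σ √(2/π)` as `z → 0` from above and from below. -/
theorem ttfR_hasDerivAt_zero (m σ lp lm : ℝ) (hσ : 0 < σ) (hlp : 0 < lp)
    (hlm : 0 < lm) :
    HasDerivAt (ttfR m σ lp lm) (σ * Real.sqrt (2 / Real.pi)) 0 ∧
    Tendsto (deriv (ttfR m σ lp lm)) (nhdsWithin 0 (Set.Ioi 0))
      (nhds (σ * Real.sqrt (2 / Real.pi))) ∧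
    Tendsto (deriv (ttfR m σ lp lm)) (nhdsWithin 0 (Set.Iio 0))
      (nhds (σ * Real.sqrt (2 / Real.pi))) := by
  have hP : ∀ z, HasDerivAt (fun z => m + σ * ttfG lp z) (σ * ttfD lp z) z := fun z =>
    ((ttfG_hasDerivAt hlp z).const_mul σ).const_add m
  have hN : ∀ z, HasDerivAt (fun z => m - σ * ttfG lm (-z)) (σ * ttfD lm (-z)) z := fun z => by
    have h := (ttfG_hasDerivAt hlm (-z)).comp z (hasDerivAt_neg z)
    refine ((h.const_mul σ).const_sub m).congr_deriv ?_
    ring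
  refine ⟨?_, ?_, ?_⟩
  · have h1 : HasDerivWithinAt (ttfR m σ lp lm) (σ * Real.sqrt (2 / Real.pi)) (Set.Ici 0) 0 := by
      have h := hP 0
      rw [ttfD_zero] at h
      exact h.hasDerivWithinAt.congr (fun z hz => ttfR_nonneg m σ lp lm hz)
        (ttfR_nonneg m σ lp lm le_rfl)
    have h2 : HasDerivWithinAt (ttfR m σ lp lm) (σ * Real.sqrt (2 / Real.pi)) (Set.Iic 0) 0 := by
      have h := hN 0
      rw [neg_zero, ttfD_zero] at h
      exact h.hasDerivWithinAt.congr (fun z hz => ttfR_nonpos m σ lp lm hz)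
        (ttfR_nonpos m σ lp lm le_rfl)
    have h3 := h2.union h1
    rwa [Set.Iic_union_Ici, hasDerivWithinAt_univ] at h3
  · have hc : Continuous fun z => σ * ttfD lp z := continuous_const.mul (ttfD_continuous lp)
    have ht := (hc.tendsto 0).mono_left (nhdsWithin_le_nhds (s := Set.Ioi 0))
    rw [ttfD_zero] at ht
    refine ht.congr' ?_
    filter_upwards [self_mem_nhdsWithin] with z hz
    refine (((hP z).congr_of_eventuallyEq ?_).deriv).symm
    filter_upwards [Ioi_mem_nhds hz] with y hy
    exact ttfR_nonneg m σ lp lm (le_of_lt hy)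
  · have hc : Continuous fun z => σ * ttfD lm (-z) :=
      continuous_const.mul ((ttfD_continuous lm).comp continuous_neg)
    have ht := (hc.tendsto 0).mono_left (nhdsWithin_le_nhds (s := Set.Iio 0))
    rw [neg_zero, ttfD_zero] at ht
    refine ht.congr' ?_
    filter_upwards [self_mem_nhdsWithin] with z hz
    refine (((hN z).congr_of_eventuallyEq ?_).deriv).symm
    filter_upwards [Iio_mem_nhds hz] with y hy
    exact ttfR_nonpos m σ lp lm (le_of_lt hy)
end
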